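/- arXiv:1207.4240 — 3 statements merged into one kernel-verified Lean document; each statement's English description precedes it below -/
import Mathlib

section
/- Let M be an n×n Hermitian positive definite complex matrix. For any subset ω ⊆ {1,…,n}, let M_ω (respectively M_ω̄) denote the principal submatrix of M obtained by keeping the rows and columns with indices in ω (respectively in the complement {1,…,n}∖ω). Then det(M) ≤ det(M_ω) · det(M_ω̄). -/
open Matrix
open scoped ComplexOrder

namespace Matrix

variable {𝕜 m n : Type*} [RCLike 𝕜] [Fintype m] [Fintype n] [DecidableEq m] [DecidableEq n]

theorem PosSemidef.one_le_det_one_add {R : Matrix n n 𝕜} (hR : R.PosSemidef) :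
    1 ≤ (1 + R).det := by
  have hH : (1 + R).IsHermitian := isHermitian_one.add hR.isHermitian
  rw [hH.det_eq_prod_eigenvalues, ← RCLike.ofReal_prod, ← RCLike.ofReal_one,
    RCLike.ofReal_le_ofReal]
  refine Finset.one_le_prod fun i _ => ?_
  have hv : RCLike.re (star ⇑(hH.eigenvectorBasis i) ⬝ᵥ ⇑(hH.eigenvectorBasis i)) = 1 := by
    rw [dotProduct_comm, ← EuclideanSpace.inner_eq_star_dotProduct, inner_self_eq_norm_sq_to_K,
      hH.eigenvectorBasis.orthonormal.1 i]
    simp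
  rw [hH.eigenvalues_eq, add_mulVec, one_mulVec, dotProduct_add, map_add, hv]
  exact le_add_of_nonneg_right (hR.re_dotProduct_nonneg _)

/-- The determinant is monotone in the Loewner order on positive semidefinite matrices. -/
theorem PosSemidef.det_le_det_add {A B : Matrix n n 𝕜} (hA : A.PosSemidef) (hB : B.PosSemidef) :
    A.det ≤ (A + B).det := by
  by_cases hdet : A.det = 0
  · exact hdet ▸ (hA.add hB).det_nonneg
  open scoped MatrixOrder in
  obtain ⟨Y, rfl⟩ := CStarAlgebra.nonneg_iff_eq_star_mul_self.mp hA.nonneg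
  rw [star_eq_conjTranspose] at hdet hA ⊢
  have hY : IsUnit Y.det := by
    rw [det_mul] at hdet
    exact (right_ne_zero_of_mul hdet).isUnit
  have hfactor : Yᴴ * Y + B = Yᴴ * (1 + Y⁻¹ᴴ * B * Y⁻¹) * Y := by
    have hYc : Yᴴ * Y⁻¹ᴴ = 1 := by
      rw [← conjTranspose_mul, nonsing_inv_mul _ hY, conjTranspose_one]
    calc Yᴴ * Y + B = Yᴴ * Y + (Yᴴ * Y⁻¹ᴴ) * B * (Y⁻¹ * Y) := by
          rw [hYc, nonsing_inv_mul _ hY, one_mul, mul_one]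
      _ = _ := by noncomm_ring
  have hle := mul_le_mul_of_nonneg_left
    (hB.conjTranspose_mul_mul_same Y⁻¹).one_le_det_one_add hA.det_nonneg
  rw [mul_one] at hle
  refine hle.trans_eq ?_
  rw [hfactor, det_mul, det_mul, det_mul]
  ring

/-- **Fischer's inequality** for a positive definite block matrix. -/
theorem PosDef.det_le_det_toBlocks₁₁_mul_det_toBlocks₂₂ {M : Matrix (m ⊕ n) (m ⊕ n) 𝕜}
    (hM : M.PosDef) : M.det ≤ M.toBlocks₁₁.det * M.toBlocks₂₂.det := by
  have hA : M.toBlocks₁₁.PosDef := hM.submatrix Sum.inl_injective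
  have hM₂₁ : M.toBlocks₂₁ = M.toBlocks₁₂ᴴ := by
    ext i j
    exact (hM.isHermitian.apply _ _).symm
  have hblocks : M = fromBlocks M.toBlocks₁₁ M.toBlocks₁₂ M.toBlocks₁₂ᴴ M.toBlocks₂₂ := by
    rw [← hM₂₁, fromBlocks_toBlocks]
  let : Invertible M.toBlocks₁₁ := hA.isUnit.invertible
  have hS := (PosDef.fromBlocks₁₁ M.toBlocks₁₂ M.toBlocks₂₂ hA).mp (hblocks ▸ hM.posSemidef)
  have hle := hS.det_le_det_add (hA.inv.posSemidef.conjTranspose_mul_mul_same M.toBlocks₁₂)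
  rw [sub_add_cancel] at hle
  calc M.det = M.toBlocks₁₁.det *
        (M.toBlocks₂₂ - M.toBlocks₁₂ᴴ * M.toBlocks₁₁⁻¹ * M.toBlocks₁₂).det := by
        conv_lhs => rw [hblocks, det_fromBlocks₁₁, invOf_eq_nonsing_inv]
    _ ≤ _ := mul_le_mul_of_nonneg_left hle hA.posSemidef.det_nonneg

end Matrix

/-- **Fischer's inequality.** For an `n × n` Hermitian positive definite complex matrix `M`
and any index set `ω ⊆ {1,…,n}`, the determinant of `M` is bounded by the product of the
determinants of the principal submatrices corresponding to `ω` and its complement. -/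
theorem det_le_det_submatrix_mul_det_submatrix_compl
    (n : ℕ) (M : Matrix (Fin n) (Fin n) ℂ) (hM : M.PosDef) (ω : Finset (Fin n)) :
    M.det ≤
      (M.submatrix (fun i : ω => (i : Fin n)) (fun i : ω => (i : Fin n))).det *
      (M.submatrix (fun i : (ωᶜ : Finset (Fin n)) => (i : Fin n))
        (fun i : (ωᶜ : Finset (Fin n)) => (i : Fin n))).det := by
  let e : (ω ⊕ (ωᶜ : Finset (Fin n))) ≃ Fin n :=
    ((Equiv.refl _).sumCongr (Equiv.subtypeEquivRight fun _ => Finset.mem_compl)).trans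
      (Equiv.sumCompl (· ∈ ω))
  rw [← det_submatrix_equiv_self e M]
  exact (hM.submatrix e.injective).det_le_det_toBlocks₁₁_mul_det_toBlocks₂₂
end

section
/- For every integer n ≥ 1, the quantities c_ℓ = (n−1)!/(ℓ! · n^{n−1−ℓ}) for 0 ≤ ℓ ≤ n−1 (i.e. c_ℓ = ((n−1)(n−2)⋯(ℓ+1))/n^{n−1−ℓ}, with c_{n−1} = 1) satisfy ∑_{ℓ=0}^{n−1} c_ℓ ≤ 2√n. -/
theorem sum_range_sub_mul_pow_div_factorial (x : ℝ) (m : ℕ) :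
    ∑ ℓ ∈ Finset.range m, (x - ℓ) * (x ^ ℓ / (Nat.factorial ℓ : ℝ)) =
      m * (x ^ m / (Nat.factorial m : ℝ)) := by
  induction m with
  | zero => simp
  | succ m ih =>
    rw [Finset.sum_range_succ, ih, Nat.factorial_succ]
    push_cast
    field_simp
    ring

theorem factorial_div_factorial_mul_pow_le_one {n ℓ : ℕ} (h : ℓ < n) :
    (Nat.factorial (n - 1) : ℝ) / ((Nat.factorial ℓ : ℝ) * (n : ℝ) ^ (n - 1 - ℓ)) ≤ 1 := by
  obtain ⟨k, rfl⟩ := Nat.exists_eq_add_of_lt h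
  have hk : ℓ + k + 1 - 1 - ℓ = k := by omega
  rw [hk, Nat.add_sub_cancel]
  refine div_le_one_of_le₀ ?_ (by positivity)
  rw [← Nat.factorial_mul_ascFactorial]
  have hpow : (ℓ + 1).ascFactorial k ≤ (ℓ + k + 1) ^ k :=
    (Nat.ascFactorial_le_pow_add ℓ k).trans (Nat.pow_le_pow_left (by omega) k)
  exact_mod_cast Nat.mul_le_mul_left _ hpow

theorem sum_range_sub_mul_factorial_div {n : ℕ} (hn : 1 ≤ n) :
    ∑ ℓ ∈ Finset.range n, ((n : ℝ) - ℓ) *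
        ((Nat.factorial (n - 1) : ℝ) / ((Nat.factorial ℓ : ℝ) * (n : ℝ) ^ (n - 1 - ℓ))) = n := by
  have hn₀ : (n : ℝ) ≠ 0 := by positivity
  calc
    _ = ∑ ℓ ∈ Finset.range n, (Nat.factorial (n - 1) : ℝ) / (n : ℝ) ^ (n - 1) *
          (((n : ℝ) - ℓ) * ((n : ℝ) ^ ℓ / (Nat.factorial ℓ : ℝ))) := by
      refine Finset.sum_congr rfl fun ℓ hℓ => ?_
      have hle : ℓ ≤ n - 1 := Nat.le_sub_one_of_lt (Finset.mem_range.mp hℓ)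
      rw [← Nat.sub_add_cancel hle, pow_add, Nat.sub_add_cancel hle]
      field_simp
    _ = n := by
      rw [← Finset.mul_sum, sum_range_sub_mul_pow_div_factorial]
      obtain ⟨N, rfl⟩ := Nat.exists_eq_add_of_le' hn
      rw [Nat.add_sub_cancel, Nat.factorial_succ, pow_succ]
      push_cast at hn₀ ⊢
      field_simp

theorem card_filter_range_sub_le (n : ℕ) {s : ℝ} (hs : 0 ≤ s) :
    (((Finset.range n).filter fun ℓ : ℕ => (n : ℝ) - ℓ ≤ s).card : ℝ) ≤ s := by
  refine le_trans ?_ (Nat.floor_le hs)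
  have hsub : ((Finset.range n).filter fun ℓ : ℕ => (n : ℝ) - ℓ ≤ s) ⊆
      Finset.Ico (n - ⌊s⌋₊) n := by
    intro ℓ hℓ
    obtain ⟨hlt, hle⟩ := Finset.mem_filter.mp hℓ
    rw [Finset.mem_range] at hlt
    have hfloor : n - ℓ ≤ ⌊s⌋₊ := Nat.le_floor (by rwa [Nat.cast_sub hlt.le])
    rw [Finset.mem_Ico]
    omega
  have hcard := Finset.card_le_card hsub
  rw [Nat.card_Ico] at hcard
  exact_mod_cast hcard.trans (by omega)

/-- The quantities `c_ℓ = (n−1)!/(ℓ! · n^{n−1−ℓ})`, `0 ≤ ℓ ≤ n−1`, satisfy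
`∑_{ℓ=0}^{n−1} c_ℓ ≤ 2 √n`. -/
theorem sum_c_le_two_sqrt (n : ℕ) (hn : 1 ≤ n) :
    ∑ ℓ ∈ Finset.range n,
        (Nat.factorial (n - 1) : ℝ) / ((Nat.factorial ℓ : ℝ) * (n : ℝ) ^ (n - 1 - ℓ)) ≤
      2 * Real.sqrt n := by
  set s := Real.sqrt n with hs
  have hs₀ : 0 < s := Real.sqrt_pos.mpr (by exact_mod_cast hn)
  calc
    _ ≤ ∑ ℓ ∈ Finset.range n, (((n : ℝ) - ℓ) * ((Nat.factorial (n - 1) : ℝ) /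
          ((Nat.factorial ℓ : ℝ) * (n : ℝ) ^ (n - 1 - ℓ))) / s +
          if (n : ℝ) - ℓ ≤ s then 1 else 0) := by
      refine Finset.sum_le_sum fun ℓ hℓ => ?_
      have hlt := Finset.mem_range.mp hℓ
      have hone := factorial_div_factorial_mul_pow_le_one hlt
      have hnonneg : (0 : ℝ) ≤ (Nat.factorial (n - 1) : ℝ) /
          ((Nat.factorial ℓ : ℝ) * (n : ℝ) ^ (n - 1 - ℓ)) := by positivity
      have hsub : (0 : ℝ) ≤ n - ℓ := sub_nonneg.mpr (by exact_mod_cast hlt.le)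
      split_ifs with h
      · exact hone.trans (le_add_of_nonneg_left (by positivity))
      · rw [add_zero, le_div_iff₀ hs₀, mul_comm]
        exact mul_le_mul_of_nonneg_right (not_le.mp h).le hnonneg
    _ = s + ((Finset.range n).filter fun ℓ : ℕ => (n : ℝ) - ℓ ≤ s).card := by
      rw [Finset.sum_add_distrib, ← Finset.sum_div, sum_range_sub_mul_factorial_div hn,
        Finset.sum_boole, hs, Real.div_sqrt]
    _ ≤ 2 * s := by linarith [card_filter_range_sub_le n hs₀.le]
end

section
/- There exists an absolute constant C > 0 such that for every integer n ≥ 1 and every real u ≥ 0, one has u · ((1+u) e^{−u})^n ≤ C n^{−1/2}. Moreover, on [0,∞) the function g(u) = u((1+u)e^{−u})^n attains its maximum at u* = (1 + √(1+4n))/(2n). -/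
/-- If `n * s ^ 2 = 1 + s`, i.e. `s` is a critical point, then `s` maximizes
`u * ((1 + u) * exp (-u)) ^ n` over `u ≥ 0`, by log-concavity. -/
theorem mul_one_add_mul_exp_neg_pow_le {n : ℕ} {s u : ℝ} (hs : 0 < s)
    (hcrit : (n : ℝ) * s ^ 2 = 1 + s) (hu : 0 ≤ u) :
    u * ((1 + u) * Real.exp (-u)) ^ n ≤ s * ((1 + s) * Real.exp (-s)) ^ n := by
  have le_mul_exp (a b : ℝ) (ha : 0 < a) : b ≤ a * Real.exp ((b - a) / a) := by
    have h : a * ((b - a) / a + 1) = b := by field_simp; ring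
    calc b = a * ((b - a) / a + 1) := h.symm
      _ ≤ a * Real.exp ((b - a) / a) := by gcongr; exact Real.add_one_le_exp _
  have hs1 : 0 < 1 + s := by linarith
  have hexp : (u - s) / s + n * ((1 + u - (1 + s)) / (1 + s) + -u) = n * -s := by
    field_simp
    linear_combination (s - u) * hcrit
  calc u * ((1 + u) * Real.exp (-u)) ^ n
      ≤ (s * Real.exp ((u - s) / s)) *
          ((1 + s) * Real.exp ((1 + u - (1 + s)) / (1 + s)) * Real.exp (-u)) ^ n := by
        gcongr
        · exact le_mul_exp s u hs
        · exact le_mul_exp (1 + s) (1 + u) hs1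
    _ = s * (1 + s) ^ n *
          Real.exp ((u - s) / s + n * ((1 + u - (1 + s)) / (1 + s) + -u)) := by
        rw [mul_assoc (1 + s), ← Real.exp_add, mul_pow, ← Real.exp_nat_mul, Real.exp_add]
        ring
    _ = s * ((1 + s) * Real.exp (-s)) ^ n := by
        rw [hexp, mul_pow, ← Real.exp_nat_mul, mul_assoc]

/-- `(1 + √(1 + 4 n)) / (2 n)` is a root of `n * s ^ 2 = 1 + s`. -/
theorem mul_sq_one_add_sqrt_div {n : ℝ} (hn : 0 < n) :
    n * ((1 + Real.sqrt (1 + 4 * n)) / (2 * n)) ^ 2 =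
      1 + (1 + Real.sqrt (1 + 4 * n)) / (2 * n) := by
  have h := Real.sq_sqrt (show 0 ≤ 1 + 4 * n by linarith)
  generalize Real.sqrt (1 + 4 * n) = r at h ⊢
  field_simp
  linear_combination h

theorem one_add_sqrt_div_le {n : ℝ} (hn : 1 ≤ n) :
    (1 + Real.sqrt (1 + 4 * n)) / (2 * n) ≤ 2 * n ^ (-(1 / 2 : ℝ)) := by
  have hn0 : 0 ≤ n := by linarith
  rw [Real.rpow_neg hn0, ← Real.sqrt_eq_rpow]
  have hr : 1 ≤ Real.sqrt n := Real.one_le_sqrt.mpr hn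
  have hsq := Real.sq_sqrt hn0
  have h3 : Real.sqrt (1 + 4 * n) ≤ 3 * Real.sqrt n :=
    Real.sqrt_le_iff.mpr ⟨by positivity, by nlinarith⟩
  rw [← div_eq_mul_inv, div_le_div_iff₀ (by linarith) (by linarith)]
  nlinarith

/-- There is an absolute constant `C > 0` with `u((1+u)e^{−u})^n ≤ C n^{−1/2}` for all
`n ≥ 1`, `u ≥ 0`; moreover on `[0,∞)` the function `g(u) = u((1+u)e^{−u})^n` attains its
maximum at `u* = (1 + √(1+4n))/(2n)`. -/
theorem g_bound_and_argmax :
    (∃ C : ℝ, 0 < C ∧ ∀ n : ℕ, 1 ≤ n → ∀ u : ℝ, 0 ≤ u →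
      u * ((1 + u) * Real.exp (-u)) ^ n ≤ C * (n : ℝ) ^ (-(1/2 : ℝ))) ∧
    (∀ n : ℕ, 1 ≤ n →
      IsMaxOn (fun u : ℝ => u * ((1 + u) * Real.exp (-u)) ^ n) (Set.Ici 0)
        ((1 + Real.sqrt (1 + 4 * (n : ℝ))) / (2 * (n : ℝ)))) := by
  have hpos (n : ℕ) (hn : 1 ≤ n) : (0 : ℝ) < n := by exact_mod_cast hn
  have hmax (n : ℕ) (hn : 1 ≤ n) (u : ℝ) (hu : 0 ≤ u) :=
    mul_one_add_mul_exp_neg_pow_le (s := (1 + Real.sqrt (1 + 4 * (n : ℝ))) / (2 * (n : ℝ)))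
      (by have := hpos n hn; positivity) (mul_sq_one_add_sqrt_div (hpos n hn)) hu
  refine ⟨⟨2, two_pos, fun n hn u hu => ?_⟩, fun n hn u hu => hmax n hn u hu⟩
  refine (hmax n hn u hu).trans
    (le_trans ?_ (one_add_sqrt_div_le (n := (n : ℝ)) (by exact_mod_cast hn)))
  have hs : 0 ≤ (1 + Real.sqrt (1 + 4 * (n : ℝ))) / (2 * (n : ℝ)) := by positivity
  refine mul_le_of_le_one_right hs (pow_le_one₀ (by positivity) ?_)
  rw [Real.exp_neg, ← div_eq_mul_inv, div_le_one (Real.exp_pos _), add_comm]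
  exact Real.add_one_le_exp _
end
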